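/- Let G be a finite group and P a set of prime numbers. The assignment C ↦ e_C defines a bijection between the set of conjugacy classes of cyclic P-perfect subgroups of G and the set of primitive idempotent elements of the ring RU_P(G). Precisely: for every cyclic P-perfect subgroup C ≤ G, the function e_C lies in RU_P(G) and is a primitive idempotent there; e_C = e_{C'} if and only if C and C' are conjugate in G; and every primitive idempotent of RU_P(G) equals e_C for some cyclic P-perfect subgroup C. -/

import Mathlib

open scoped Classical

/-- The subring `ℤ_(P) = ℤ[1/p : p ∉ P]` of `ℚ`, viewed inside `ℂ`. -/
noncomputable def ZPloc (P : Set ℕ) : Subring ℂ :=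
  Subring.closure {z : ℂ | ∃ p : ℕ, p.Prime ∧ p ∉ P ∧ z = (p : ℂ)⁻¹}

/-- `b` is the `P'`-part of `g`. -/
def IsPPrimePart {G : Type} [Group G] (P : Set ℕ) (g b : G) : Prop :=
  b ∈ Subgroup.zpowers g ∧
    (∀ p : ℕ, p.Prime → p ∣ orderOf b → p ∉ P) ∧
    (∀ p : ℕ, p.Prime → p ∣ orderOf (g * b⁻¹) → p ∈ P)

/-- Two subgroups of `G` are conjugate in `G`. -/
def SubConj {G : Type} [Group G] (C C' : Subgroup G) : Prop :=
  ∃ g : G, Subgroup.map (MulAut.conj g).toMonoidHom C = C'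

/-- `C` is a cyclic subgroup whose order is not divisible by any prime in `P`. -/
def CyclicPPerfect {G : Type} [Group G] (P : Set ℕ) (C : Subgroup G) : Prop :=
  IsCyclic C ∧ ∀ p : ℕ, p.Prime → p ∈ P → ¬ p ∣ Nat.card C

/-- The idempotent class function `e_C : G → ℂ`, equal to `1` at `g` iff `⟨g_{P'}⟩` is
conjugate in `G` to `C`, and `0` otherwise. -/
noncomputable def eIdem {G : Type} [Group G] (P : Set ℕ) (C : Subgroup G) : G → ℂ :=
  fun g => if ∃ b : G, IsPPrimePart P g b ∧ SubConj (Subgroup.zpowers b) C then 1 else 0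

/-- `RU_P(G)`: the set of `ℤ_(P)`-linear combinations, inside the ring of functions
`G → ℂ`, of characters of finite-dimensional complex representations of `G`. -/
noncomputable def RUP (G : Type) [Group G] [Fintype G] (P : Set ℕ) : Set (G → ℂ) :=
  {f | ∃ (n : ℕ) (c : Fin n → ℂ) (V : Fin n → FDRep ℂ G),
    (∀ i, c i ∈ ZPloc P) ∧ f = ∑ i, c i • (V i).character}

/-- `e` is a primitive idempotent of the (sub)ring with underlying set `S`: it is a nonzero
idempotent of `S` that cannot be written as a sum of two nonzero orthogonal idempotents
of `S`. -/
def IsPrimitiveIdempotentIn {G : Type} (S : Set (G → ℂ)) (e : G → ℂ) : Prop :=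
  e ∈ S ∧ e * e = e ∧ e ≠ 0 ∧
    ∀ e₁ e₂ : G → ℂ, e₁ ∈ S → e₂ ∈ S → e₁ * e₁ = e₁ → e₂ * e₂ = e₂ → e₁ * e₂ = 0 →
      e = e₁ + e₂ → e₁ = 0 ∨ e₂ = 0

section Trace

/-- The trace of the powers of an endomorphism of finite order is a power sum of roots of unity. -/
theorem LinearMap.exists_trace_pow_eq_sum {V : Type*} [AddCommGroup V] [Module ℂ V]
    [FiniteDimensional ℂ V] (f : Module.End ℂ V) {n : ℕ} (hn : n ≠ 0) (hf : f ^ n = 1) :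
    ∃ (s : Finset ℂ) (d : ℂ → ℕ), (∀ μ ∈ s, μ ^ n = 1) ∧
      ∀ k : ℕ, LinearMap.trace ℂ V (f ^ k) = ∑ μ ∈ s, (d μ : ℂ) * μ ^ k := by
  have hss : f.IsSemisimple := by
    refine Module.End.isSemisimple_of_squarefree_aeval_eq_zero
      (p := (Polynomial.X ^ n - 1 : Polynomial ℂ)) ?_ ?_
    · exact (Polynomial.X_pow_sub_one_separable_iff.2 (by exact_mod_cast hn)).squarefree
    · simp [hf]
  have hint : DirectSum.IsInternal f.eigenspace :=
    (DirectSum.isInternal_submodule_iff_iSupIndep_and_iSup_eq_top _).2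
      ⟨f.eigenspaces_iSupIndep, hss.iSup_eigenspace_eq_top⟩
  have hfin : {μ | f.eigenspace μ ≠ ⊥}.Finite :=
    WellFoundedGT.finite_ne_bot_of_iSupIndep f.eigenspaces_iSupIndep
  have hpow : ∀ (μ : ℂ) (v : V), v ∈ f.eigenspace μ → ∀ k : ℕ, (f ^ k) v = μ ^ k • v := by
    intro μ v hv k
    induction k with
    | zero => simp
    | succ k ih =>
      rw [pow_succ', Module.End.mul_apply, ih, map_smul, Module.End.mem_eigenspace_iff.1 hv,
        smul_smul, pow_succ]
  refine ⟨hfin.toFinset, fun μ => Module.finrank ℂ (f.eigenspace μ), ?_, ?_⟩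
  · intro μ hμ
    rw [Set.Finite.mem_toFinset] at hμ
    obtain ⟨v, hv, hv0⟩ := (Submodule.ne_bot_iff _).1 hμ
    have h := hpow μ v hv n
    rw [hf, Module.End.one_apply] at h
    have h' : (μ ^ n - 1) • v = 0 := by rw [sub_smul, one_smul, ← h, sub_self]
    rcases smul_eq_zero.1 h' with h' | h'
    · exact sub_eq_zero.1 h'
    · exact absurd h' hv0
  · intro k
    have hmaps : ∀ μ, Set.MapsTo (f ^ k) (f.eigenspace μ) (f.eigenspace μ) := by
      intro μ v hv
      rw [SetLike.mem_coe, hpow μ v hv k]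
      exact Submodule.smul_mem _ _ hv
    rw [LinearMap.trace_eq_sum_trace_restrict' hint hfin hmaps]
    refine Finset.sum_congr rfl fun μ _ => ?_
    have : (f ^ k).restrict (hmaps μ) = (μ ^ k) • LinearMap.id := by
      ext v
      exact hpow μ v v.2 k
    rw [this, map_smul, LinearMap.trace_id, smul_eq_mul, mul_comm]

theorem FDRep.exists_char_pow_eq_sum {G : Type} [Group G] [Finite G] (V : FDRep ℂ G) (g : G) :
    ∃ (s : Finset ℂ) (d : ℂ → ℕ), (∀ μ ∈ s, IsIntegral ℤ μ) ∧
      ∀ k : ℕ, V.character (g ^ k) = ∑ μ ∈ s, (d μ : ℂ) * μ ^ k := by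
  obtain ⟨s, d, hs, hd⟩ := LinearMap.exists_trace_pow_eq_sum (V.ρ g) (orderOf_pos g).ne'
    (by rw [← map_pow, pow_orderOf_eq_one, map_one])
  refine ⟨s, d, fun μ hμ => ?_, fun k => ?_⟩
  · exact IsIntegral.of_pow (orderOf_pos g) (by rw [hs μ hμ]; exact isIntegral_one)
  · rw [← hd, ← map_pow]; rfl

end Trace

section Frobenius

/-- Modulo a prime `q`, raising to the `q`-th power is additive. -/
theorem Nat.Prime.dvd_add_pow_sub {R : Type*} [CommRing R] {q : ℕ} (hq : q.Prime)
    {a b a' b' : R} (h : (q : R) ∣ a ^ q - b) (h' : (q : R) ∣ a' ^ q - b') :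
    (q : R) ∣ (a + a') ^ q - (b + b') := by
  obtain ⟨r, hr⟩ := exists_add_pow_prime_eq hq a a'
  rw [hr]
  have : a ^ q + a' ^ q + q * a * a' * r - (b + b') =
      (a ^ q - b) + (a' ^ q - b') + q * (a * a' * r) := by ring
  exact this ▸ dvd_add (dvd_add h h') (dvd_mul_right _ _)

theorem natCast_dvd_mul_pow_sub {R : Type*} [CommRing R] {q : ℕ}
    {a b a' b' : R} (h : (q : R) ∣ a ^ q - b) (h' : (q : R) ∣ a' ^ q - b') :
    (q : R) ∣ (a * a') ^ q - b * b' := by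
  have : (a * a') ^ q - b * b' = (a ^ q - b) * a' ^ q + b * (a' ^ q - b') := by ring
  exact this ▸ dvd_add (h.mul_right _) (h'.mul_left _)

theorem Nat.Prime.dvd_sum_pow_sub {R ι : Type*} [CommRing R] {q : ℕ} (hq : q.Prime)
    (s : Finset ι) {a b : ι → R} (h : ∀ i ∈ s, (q : R) ∣ a i ^ q - b i) :
    (q : R) ∣ (∑ i ∈ s, a i) ^ q - ∑ i ∈ s, b i := by
  induction s using Finset.induction_on with
  | empty => simp [hq.ne_zero]
  | insert i s hi ih =>
    rw [Finset.sum_insert hi, Finset.sum_insert hi]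
    exact hq.dvd_add_pow_sub (h i (Finset.mem_insert_self i s))
      (ih fun j hj => h j (Finset.mem_insert_of_mem hj))

theorem Nat.Prime.dvd_intCast_pow_sub {R : Type*} [CommRing R] {q : ℕ} (hq : q.Prime) (z : ℤ) :
    (q : R) ∣ (z : R) ^ q - z := by
  have := Fact.mk hq
  have h : (q : ℤ) ∣ z ^ q - z := by
    rw [← ZMod.intCast_zmod_eq_zero_iff_dvd]
    push_cast
    rw [ZMod.pow_card, sub_self]
  simpa using map_dvd (Int.castRingHom R) h

/-- An integer divisible by `q` among algebraic integers is divisible by `q`. -/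
theorem Int.dvd_of_natCast_dvd_integralClosure {q : ℕ} (hq : q ≠ 0) {z : ℤ}
    (h : (q : integralClosure ℤ ℂ) ∣ (z : integralClosure ℤ ℂ)) : (q : ℤ) ∣ z := by
  obtain ⟨w, hw⟩ := h
  have hw' : (z : ℂ) = q * (w : ℂ) := by simpa using congrArg Subtype.val hw
  have hq' : (q : ℚ) ≠ 0 := by exact_mod_cast hq
  have hwq : (w : ℂ) = algebraMap ℚ ℂ (z / q : ℚ) := by
    have : (q : ℂ) ≠ 0 := by exact_mod_cast hq
    simp only [eq_ratCast]
    push_cast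
    rw [hw']; field_simp
  have hint : IsIntegral ℤ (z / q : ℚ) := by
    refine (isIntegral_algHom_iff (IsScalarTower.toAlgHom ℤ ℚ ℂ)
      (algebraMap ℚ ℂ).injective).1 ?_
    have := w.2
    rw [hwq] at this
    exact this
  obtain ⟨y, hy⟩ := IsIntegrallyClosed.isIntegral_iff.1 hint
  refine ⟨y, ?_⟩
  have : (z : ℚ) = q * y := by
    simp only [eq_intCast] at hy
    rw [hy]; field_simp
  exact_mod_cast this

theorem FDRep.exists_integral_char_pow_prime {G : Type} [Group G] [Finite G] (V : FDRep ℂ G)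
    (g : G) {q : ℕ} (hq : q.Prime) :
    ∃ a b : integralClosure ℤ ℂ, (a : ℂ) = V.character g ∧ (b : ℂ) = V.character (g ^ q) ∧
      (q : integralClosure ℤ ℂ) ∣ a ^ q - b := by
  obtain ⟨s, d, hs, hd⟩ := V.exists_char_pow_eq_sum g
  refine ⟨∑ μ ∈ s.attach, ((d μ.1 : ℤ) : integralClosure ℤ ℂ) * ⟨μ, hs μ.1 μ.2⟩,
    ∑ μ ∈ s.attach, ((d μ.1 : ℤ) : integralClosure ℤ ℂ) * ⟨μ, hs μ.1 μ.2⟩ ^ q, ?_, ?_, ?_⟩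
  · have := hd 1
    rw [pow_one] at this
    rw [this, ← Finset.sum_attach s]
    simp
  · rw [hd q, ← Finset.sum_attach s]
    simp
  · exact hq.dvd_sum_pow_sub _ fun μ _ =>
      natCast_dvd_mul_pow_sub (hq.dvd_intCast_pow_sub _) (by simp)

end Frobenius

section Localization

theorem inv_natCast_mem_ZPloc {P : Set ℕ} {d : ℕ} (h : ∀ p : ℕ, p.Prime → p ∣ d → p ∉ P) :
    (d : ℂ)⁻¹ ∈ ZPloc P := by
  induction d using Nat.recOnMul with
  | zero => simp
  | one => simp
  | prime p hp => exact Subring.subset_closure ⟨p, hp, h p hp dvd_rfl, rfl⟩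
  | mul a b ha hb =>
    rw [Nat.cast_mul, mul_inv]
    exact Subring.mul_mem _ (ha fun p hp hd => h p hp (hd.mul_right _))
      (hb fun p hp hd => h p hp (hd.mul_left _))

theorem exists_natCast_mul_eq_intCast_of_mem_ZPloc {P : Set ℕ} {c : ℂ} (hc : c ∈ ZPloc P) :
    ∃ (M : ℕ) (a : ℤ), M ≠ 0 ∧ (∀ p : ℕ, p.Prime → p ∣ M → p ∉ P) ∧ (M : ℂ) * c = a := by
  have mul_aux : ∀ {M N : ℕ}, (∀ p : ℕ, p.Prime → p ∣ M → p ∉ P) →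
      (∀ p : ℕ, p.Prime → p ∣ N → p ∉ P) → ∀ p : ℕ, p.Prime → p ∣ M * N → p ∉ P :=
    fun hM hN p hp hd => (hp.dvd_mul.1 hd).elim (hM p hp) (hN p hp)
  induction hc using Subring.closure_induction with
  | mem x hx =>
    obtain ⟨p, hp, hpP, rfl⟩ := hx
    refine ⟨p, 1, hp.ne_zero, fun r hr hd => ?_, ?_⟩
    · rwa [(Nat.prime_dvd_prime_iff_eq hr hp).1 hd]
    · have : (p : ℂ) ≠ 0 := by exact_mod_cast hp.ne_zero
      simp [this]
  | zero => exact ⟨1, 0, one_ne_zero, fun p hp hd => absurd (Nat.dvd_one.1 hd) hp.ne_one, by simp⟩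
  | one => exact ⟨1, 1, one_ne_zero, fun p hp hd => absurd (Nat.dvd_one.1 hd) hp.ne_one, by simp⟩
  | add x y _ _ hx hy =>
    obtain ⟨M, a, hM, hMP, ha⟩ := hx
    obtain ⟨N, b, hN, hNP, hb⟩ := hy
    refine ⟨M * N, N * a + M * b, mul_ne_zero hM hN, mul_aux hMP hNP, ?_⟩
    push_cast
    rw [← ha, ← hb]; ring
  | neg x _ hx =>
    obtain ⟨M, a, hM, hMP, ha⟩ := hx
    exact ⟨M, -a, hM, hMP, by push_cast; rw [← ha]; ring⟩
  | mul x y _ _ hx hy =>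
    obtain ⟨M, a, hM, hMP, ha⟩ := hx
    obtain ⟨N, b, hN, hNP, hb⟩ := hy
    refine ⟨M * N, a * b, mul_ne_zero hM hN, mul_aux hMP hNP, ?_⟩
    push_cast
    rw [← ha, ← hb]; ring

end Localization

section CharacterRing

open CategoryTheory MonoidalCategory

theorem FDRep.char_trivial {G : Type} [Group G] :
    (FDRep.of (Representation.trivial ℂ G ℂ)).character = 1 := by
  ext g
  simp [FDRep.character]

variable {G : Type} [Group G] [Fintype G]

theorem RUP_eq_span (P : Set ℕ) :
    RUP G P = Submodule.span (ZPloc P) (Set.range fun V : FDRep ℂ G => V.character) := by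
  ext f
  rw [SetLike.mem_coe, Submodule.mem_span_set']
  constructor
  · rintro ⟨n, c, V, hc, rfl⟩
    exact ⟨n, fun i => ⟨c i, hc i⟩, fun i => ⟨_, V i, rfl⟩, rfl⟩
  · rintro ⟨n, c, g, rfl⟩
    choose V hV using fun i => (g i).2
    refine ⟨n, fun i => c i, V, fun i => (c i).2, Finset.sum_congr rfl fun i _ => ?_⟩
    rw [← hV i]; rfl

variable (G) in
/-- The ring `RU_P(G)` as a subalgebra over `ℤ_(P)` of the algebra of functions on `G`. -/
noncomputable def characterRing (P : Set ℕ) : Subalgebra (ZPloc P) (G → ℂ) :=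
  (Submodule.span (ZPloc P) (Set.range fun V : FDRep ℂ G => V.character)).toSubalgebra
    (Submodule.subset_span ⟨_, FDRep.char_trivial⟩) (by
      intro x y hx hy
      induction hx, hy using Submodule.span_induction₂ with
      | mem_mem x y hx hy =>
        obtain ⟨V, rfl⟩ := hx
        obtain ⟨W, rfl⟩ := hy
        exact Submodule.subset_span ⟨V ⊗ W, FDRep.char_tensor V W⟩
      | zero_left y hy => simp
      | zero_right x hx => simp
      | add_left x y z _ _ _ h1 h2 => rw [add_mul]; exact add_mem h1 h2
      | add_right x y z _ _ _ h1 h2 => rw [mul_add]; exact add_mem h1 h2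
      | smul_left r x y _ _ h => rw [smul_mul_assoc]; exact Submodule.smul_mem _ r h
      | smul_right r x y _ _ h => rw [mul_smul_comm]; exact Submodule.smul_mem _ r h)

theorem mem_characterRing {P : Set ℕ} {f : G → ℂ} : f ∈ characterRing G P ↔ f ∈ RUP G P := by
  rw [RUP_eq_span]; rfl

variable (G) in
/-- The integer-valued functions in `RU_P(G)`. -/
noncomputable def intCharacterRing (P : Set ℕ) : Subring (G → ℤ) :=
  (characterRing G P).toSubring.comap ((Int.castRingHom ℂ).compLeft G)

theorem mem_intCharacterRing {P : Set ℕ} {f : G → ℤ} :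
    f ∈ intCharacterRing G P ↔ (fun g => (f g : ℂ)) ∈ RUP G P := by
  rw [← mem_characterRing]; rfl

theorem mem_intCharacterRing_of_natCast_mul {P : Set ℕ} {f : G → ℤ} {d : ℕ} (hd : d ≠ 0)
    (h : ∀ p : ℕ, p.Prime → p ∣ d → p ∉ P) (hf : (d : G → ℤ) * f ∈ intCharacterRing G P) :
    f ∈ intCharacterRing G P := by
  rw [mem_intCharacterRing, ← mem_characterRing] at hf ⊢
  have := (characterRing G P).smul_mem hf ⟨_, inv_natCast_mem_ZPloc h⟩
  convert this using 1
  ext g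
  have hd' : (d : ℂ) ≠ 0 := by exact_mod_cast hd
  change _ = (d : ℂ)⁻¹ * (((d * f g : ℤ)) : ℂ)
  push_cast
  field_simp

theorem apply_conj_of_mem_intCharacterRing {P : Set ℕ} {f : G → ℤ}
    (hf : f ∈ intCharacterRing G P) (x g : G) : f (x * g * x⁻¹) = f g := by
  obtain ⟨n, c, V, -, h⟩ := mem_intCharacterRing.1 hf
  have key : ∀ g, (f g : ℂ) = ∑ i, c i * (V i).character g := fun g => by
    simpa using congrFun h g
  have : (f (x * g * x⁻¹) : ℂ) = f g := by
    rw [key, key]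
    simp_rw [FDRep.char_conj]
  exact_mod_cast this

/-- For all primes `q` not inverted in the coefficients, `f (g ^ q) ≡ f g` modulo `q`. -/
theorem exists_forall_prime_dvd_apply_pow_sub {P : Set ℕ} {f : G → ℤ}
    (hf : f ∈ intCharacterRing G P) :
    ∃ M : ℕ, M ≠ 0 ∧ (∀ p : ℕ, p.Prime → p ∣ M → p ∉ P) ∧
      ∀ q : ℕ, q.Prime → ¬ q ∣ M → ∀ g, (q : ℤ) ∣ f (g ^ q) - f g := by
  obtain ⟨n, c, V, hc, h⟩ := mem_intCharacterRing.1 hf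
  choose M a hM hMP hMa using fun i => exists_natCast_mul_eq_intCast_of_mem_ZPloc (hc i)
  refine ⟨∏ i, M i, Finset.prod_ne_zero_iff.2 fun i _ => hM i, fun p hp hd => ?_,
    fun q hq hqM g => ?_⟩
  · obtain ⟨i, -, hi⟩ := (hp.prime.dvd_finsetProd_iff _).1 hd
    exact hMP i p hp hi
  · set N := ∏ i, M i
    let b : Fin n → ℤ := fun i => (∏ j ∈ Finset.univ.erase i, (M j : ℤ)) * a i
    have hb : ∀ i, (N : ℂ) * c i = b i := by
      intro i
      have : N = (∏ j ∈ Finset.univ.erase i, M j) * M i :=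
        (Finset.prod_erase_mul _ _ (Finset.mem_univ i)).symm
      rw [this]
      simp only [b]
      push_cast
      rw [mul_assoc, hMa]
    have key : ∀ x, ((N * f x : ℤ) : ℂ) = ∑ i, b i * (V i).character x := fun x => by
      have := congrFun h x
      simp only [Finset.sum_apply, Pi.smul_apply, smul_eq_mul] at this
      push_cast
      rw [this, Finset.mul_sum]
      refine Finset.sum_congr rfl fun i _ => ?_
      rw [← hb]; ring
    choose u v hu hv huv using fun i => (V i).exists_integral_char_pow_prime g hq
    have h1 : ((N * f g : ℤ) : integralClosure ℤ ℂ) = ∑ i, (b i : integralClosure ℤ ℂ) * u i := by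
      apply Subtype.ext
      have := key g
      simp only [← hu] at this
      simpa using this
    have h2 : ((N * f (g ^ q) : ℤ) : integralClosure ℤ ℂ) =
        ∑ i, (b i : integralClosure ℤ ℂ) * v i := by
      apply Subtype.ext
      have := key (g ^ q)
      simp only [← hv] at this
      simpa using this
    have h3 := hq.dvd_sum_pow_sub Finset.univ fun i _ =>
      natCast_dvd_mul_pow_sub (hq.dvd_intCast_pow_sub (b i)) (huv i)
    rw [← h1, ← h2] at h3
    have h4 := dvd_sub (hq.dvd_intCast_pow_sub (R := integralClosure ℤ ℂ) (N * f g)) h3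
    rw [sub_sub_sub_cancel_left, ← Int.cast_sub] at h4
    have h5 := Int.dvd_of_natCast_dvd_integralClosure hq.ne_zero h4
    rw [← mul_sub] at h5
    exact ((Nat.prime_iff_prime_int.1 hq).dvd_or_dvd h5).resolve_left
      (by exact_mod_cast hqM)

theorem dvd_apply_pow_sub_of_mem_intCharacterRing {P : Set ℕ} {f : G → ℤ}
    (hf : f ∈ intCharacterRing G P) {p : ℕ} (hp : p.Prime) (hpP : p ∈ P) (g : G) :
    (p : ℤ) ∣ f (g ^ p) - f g := by
  obtain ⟨M, -, hMP, h⟩ := exists_forall_prime_dvd_apply_pow_sub hf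
  exact h p hp (fun hd => hMP p hp hd hpP) g

/-- An integer-valued virtual character takes the same value on the generators of a cyclic
subgroup. -/
theorem apply_pow_eq_of_mem_intCharacterRing {P : Set ℕ} {f : G → ℤ}
    (hf : f ∈ intCharacterRing G P) {g : G} {k : ℕ} (hk : k.Coprime (orderOf g)) :
    f (g ^ k) = f g := by
  obtain ⟨M, hM, -, h⟩ := exists_forall_prime_dvd_apply_pow_sub hf
  have : NeZero (orderOf g) := ⟨(orderOf_pos g).ne'⟩
  obtain ⟨q, hqgt, hq, hqk⟩ := Nat.forall_exists_prime_gt_and_eq_mod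
    (ZMod.isUnit_iff_coprime k (orderOf g) |>.2 hk) (M + (f (g ^ k) - f g).natAbs)
  have hgq : g ^ q = g ^ k :=
    pow_eq_pow_iff_modEq.2 ((ZMod.natCast_eq_natCast_iff _ _ _).1 hqk)
  have hd := h q hq (fun hd => by have := Nat.le_of_dvd (Nat.pos_of_ne_zero hM) hd; omega) g
  rw [hgq] at hd
  exact sub_eq_zero.1 (Int.eq_zero_of_abs_lt_dvd hd (by rw [Int.abs_eq_natAbs]; omega))

end CharacterRing

section PermutationCharacter

variable {G : Type} [Group G] [Fintype G]

/-- The permutation character of `G` acting on the cosets of `H`. -/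
noncomputable def permChar (H : Subgroup G) (g : G) : ℤ :=
  (Nat.card {x : G ⧸ H // g • x = x} : ℤ)

theorem LinearMap.trace_funLeft {X : Type*} [Fintype X] (σ : X → X) :
    LinearMap.trace ℂ (X → ℂ) (LinearMap.funLeft ℂ ℂ σ) = Nat.card {x : X // σ x = x} := by
  rw [LinearMap.trace_eq_matrix_trace ℂ (Pi.basisFun ℂ X), Matrix.trace, Nat.card_eq_fintype_card,
    Fintype.card_subtype, Finset.card_filter]
  push_cast
  refine Finset.sum_congr rfl fun x _ => ?_
  simp [Pi.single_apply]

theorem permChar_mem (P : Set ℕ) (H : Subgroup G) : permChar H ∈ intCharacterRing G P := by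
  let ρ : Representation ℂ G (G ⧸ H → ℂ) :=
    { toFun := fun g => LinearMap.funLeft ℂ ℂ fun x => g⁻¹ • x
      map_one' := by ext; simp
      map_mul' := fun a b => by
        refine LinearMap.ext fun f => funext fun x => ?_
        simp [LinearMap.funLeft_apply, mul_smul] }
  rw [mem_intCharacterRing]
  refine ⟨1, fun _ => 1, fun _ => FDRep.of ρ, fun _ => one_mem _, ?_⟩
  ext g
  have : (FDRep.of ρ).character g = LinearMap.trace ℂ _ (ρ g) := rfl
  simp only [Finset.univ_unique, Finset.sum_singleton, one_smul, this]
  change _ = LinearMap.trace ℂ _ (LinearMap.funLeft ℂ ℂ fun x : G ⧸ H => g⁻¹ • x)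
  rw [LinearMap.trace_funLeft]
  have hfix : ∀ x : G ⧸ H, g⁻¹ • x = x ↔ g • x = x := fun x => by rw [inv_smul_eq_iff, eq_comm]
  simp only [permChar, Int.cast_natCast, hfix]

omit [Fintype G] in
theorem smul_mk_eq_iff {H : Subgroup G} {g x : G} :
    g • (x : G ⧸ H) = x ↔ x⁻¹ * g * x ∈ H := by
  rw [eq_comm, MulAction.Quotient.smul_coe, QuotientGroup.eq, smul_eq_mul, mul_assoc]

theorem permChar_ne_zero_iff {H : Subgroup G} {g : G} :
    permChar H g ≠ 0 ↔ ∃ x, x⁻¹ * g * x ∈ H := by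
  rw [permChar, Ne, Nat.cast_eq_zero, Finite.card_eq_zero_iff, not_isEmpty_iff]
  constructor
  · rintro ⟨⟨x, hx⟩⟩
    induction x using QuotientGroup.induction_on with
    | H x => exact ⟨x, smul_mk_eq_iff.1 hx⟩
  · rintro ⟨x, hx⟩
    exact ⟨⟨x, smul_mk_eq_iff.2 hx⟩⟩

/-- For a `p'`-element `b` there is a subgroup whose `p'`-elements are powers of `b` and
whose permutation character at `b` is prime to `p`. -/
theorem exists_not_dvd_permChar {p : ℕ} (hp : p.Prime) {b : G} (hb : (orderOf b).Coprime p) :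
    ∃ H : Subgroup G, (∀ y ∈ H, (orderOf y).Coprime p → y ∈ Subgroup.zpowers b) ∧
      ¬ (p : ℤ) ∣ permChar H b := by
  have := Fact.mk hp
  let D := Subgroup.zpowers b
  let N := Subgroup.normalizer (D : Set G)
  let D' := D.subgroupOf N
  have hD' : D'.Normal := Subgroup.normal_in_normalizer
  let Q : Sylow p (N ⧸ D') := default
  let H₀ : Subgroup N := (Q : Subgroup (N ⧸ D')).comap (QuotientGroup.mk' D')
  let H : Subgroup G := H₀.map N.subtype
  have hDN : D ≤ N := Subgroup.le_normalizer
  have hbH : b ∈ H := by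
    refine ⟨⟨b, hDN (Subgroup.mem_zpowers b)⟩, ?_, rfl⟩
    have : QuotientGroup.mk' D' ⟨b, hDN (Subgroup.mem_zpowers b)⟩ = 1 :=
      (QuotientGroup.eq_one_iff _).2 (Subgroup.mem_subgroupOf.2 (Subgroup.mem_zpowers b))
    change _ ∈ (Q : Subgroup (N ⧸ D'))
    rw [this]; exact one_mem _
  have hH : ∀ y ∈ H, (orderOf y).Coprime p → y ∈ D := by
    rintro _ ⟨y, hy, rfl⟩ hyp
    have h1 : orderOf (QuotientGroup.mk' D' y) ∣ orderOf y := orderOf_map_dvd _ _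
    rw [Subgroup.coe_subtype, Subgroup.orderOf_coe] at hyp
    obtain ⟨k, hk⟩ := Q.isPGroup' ⟨_, hy⟩
    have h2 : orderOf (QuotientGroup.mk' D' y) ∣ p ^ k :=
      orderOf_dvd_of_pow_eq_one (congrArg Subtype.val hk)
    have h3 : orderOf (QuotientGroup.mk' D' y) = 1 :=
      Nat.eq_one_of_dvd_coprimes (hyp.pow_right k) h1 h2
    exact Subgroup.mem_subgroupOf.1 ((QuotientGroup.eq_one_iff _).1 (orderOf_eq_one_iff.1 h3))
  refine ⟨H, hH, ?_⟩
  have hpre : (QuotientGroup.mk : G → G ⧸ H) ⁻¹' {x | b • x = x} = (N : Set G) := by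
    ext x
    rw [Set.mem_preimage, Set.mem_ofPred_eq, smul_mk_eq_iff, SetLike.mem_coe,
      ← inv_mem_iff (x := x), Subgroup.mem_normalizer_iff_map_conj_eq]
    have hconj : (MulAut.conj x⁻¹) b = x⁻¹ * b * x := by simp
    have hmap : D.map (MulAut.conj x⁻¹) = Subgroup.zpowers (x⁻¹ * b * x) := by
      rw [← hconj]; exact MonoidHom.map_zpowers _ b
    have hord : orderOf (x⁻¹ * b * x) = orderOf b := by
      rw [← hconj]; exact MulEquiv.orderOf_eq _ b
    constructor
    · intro h
      rw [hmap]
      refine Subgroup.eq_of_le_of_card_ge (Subgroup.zpowers_le.2 (hH _ h (hord ▸ hb))) ?_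
      rw [Nat.card_zpowers, Nat.card_zpowers, hord]
    · intro h
      rw [hmap] at h
      have : x⁻¹ * b * x ∈ D := h ▸ Subgroup.mem_zpowers _
      exact (Subgroup.zpowers_le.2 hbH) this
  have hcard : Nat.card N = Nat.card H * Nat.card {x : G ⧸ H // b • x = x} := by
    rw [← Nat.card_prod]
    exact Nat.card_congr ((Equiv.setCongr hpre.symm).trans
      (QuotientGroup.preimageMkEquivSubgroupProdSet H {x | b • x = x}))
  have hH₀ : Nat.card H = Nat.card H₀ :=
    Subgroup.card_map_of_injective N.subtype_injective
  have hidx : Nat.card {x : G ⧸ H // b • x = x} = H₀.index := by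
    rw [hH₀, ← H₀.card_mul_index] at hcard
    exact (Nat.eq_of_mul_eq_mul_left Nat.card_pos hcard).symm
  rw [permChar, hidx, Subgroup.index_comap_of_surjective _ (QuotientGroup.mk'_surjective D')]
  exact_mod_cast Q.not_dvd_index

end PermutationCharacter

section PowerClasses

variable {G : Type} [Group G]

/-- The cyclic group generated by `g ^ K` is conjugate to a subgroup of the one generated
by `h ^ K`. -/
def PowSubconj (K : ℕ) (g h : G) : Prop :=
  ∃ x, x * g ^ K * x⁻¹ ∈ Subgroup.zpowers (h ^ K)

theorem PowSubconj.refl (K : ℕ) (g : G) : PowSubconj K g g :=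
  ⟨1, by simp⟩

theorem PowSubconj.trans {K : ℕ} {g h l : G} (h₁ : PowSubconj K g h) (h₂ : PowSubconj K h l) :
    PowSubconj K g l := by
  obtain ⟨x, i, hx⟩ := h₁
  obtain ⟨y, hy⟩ := h₂
  refine ⟨y * x, ?_⟩
  have : y * x * g ^ K * (y * x)⁻¹ = (y * h ^ K * y⁻¹) ^ i := by
    rw [conj_zpow]
    simp only at hx
    rw [hx]; group
  rw [this]
  exact zpow_mem hy i

theorem PowSubconj.mono {K K' : ℕ} (hK : K ∣ K') {g h : G} (hgh : PowSubconj K g h) :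
    PowSubconj K' g h := by
  obtain ⟨m, rfl⟩ := hK
  obtain ⟨x, i, hx⟩ := hgh
  refine ⟨x, i, ?_⟩
  simp only at hx ⊢
  rw [pow_mul, pow_mul, ← conj_pow, ← hx, ← zpow_natCast, ← zpow_mul, ← zpow_natCast _ m,
    ← zpow_mul, mul_comm]

theorem powSubconj_one_pow_iff {K : ℕ} {g h : G} :
    PowSubconj 1 (g ^ K) (h ^ K) ↔ PowSubconj K g h := by
  simp [PowSubconj]

variable (G) in
/-- Two elements are related if the cyclic groups generated by their `K`-th powers are
conjugate. -/
def powSetoid (K : ℕ) : Setoid G where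
  r g h := PowSubconj K g h ∧ PowSubconj K h g
  iseqv := ⟨fun g => ⟨.refl K g, .refl K g⟩, fun h => ⟨h.2, h.1⟩,
    fun h h' => ⟨h.1.trans h'.1, h'.2.trans h.2⟩⟩

/-- The function is constant on the classes of `powSetoid G K`. -/
def IsPowClassFun (K : ℕ) (f : G → ℤ) : Prop :=
  ∀ g h, powSetoid G K g h → f g = f h

theorem IsPowClassFun.of_dvd {K K' : ℕ} (hK : K ∣ K') {f : G → ℤ} (hf : IsPowClassFun K' f) :
    IsPowClassFun K f :=
  fun g h hgh => hf g h ⟨hgh.1.mono hK, hgh.2.mono hK⟩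

/-- The indicator function of the class of `g`. -/
noncomputable def powClassInd (K : ℕ) (g : G) : G → ℤ :=
  fun x => if powSetoid G K x g then 1 else 0

theorem isPowClassFun_powClassInd (K : ℕ) (g : G) : IsPowClassFun K (powClassInd K g) := by
  intro x y hxy
  have : powSetoid G K x g ↔ powSetoid G K y g :=
    ⟨(powSetoid G K).trans' ((powSetoid G K).symm' hxy), (powSetoid G K).trans' hxy⟩
  simp [powClassInd, this]

theorem subConj_zpowers_iff [Finite G] {a b : G} :
    SubConj (Subgroup.zpowers a) (Subgroup.zpowers b) ↔ powSetoid G 1 a b := by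
  have hmap : ∀ (x c : G), (Subgroup.zpowers c).map (MulAut.conj x).toMonoidHom =
      Subgroup.zpowers (x * c * x⁻¹) := fun x c => by
    rw [MonoidHom.map_zpowers]; simp
  have hord : ∀ x c : G, orderOf (x * c * x⁻¹) = orderOf c := fun x c => by
    rw [← MulAut.conj_apply]; exact MulEquiv.orderOf_eq _ c
  constructor
  · rintro ⟨x, hx⟩
    rw [hmap] at hx
    refine ⟨⟨x, ?_⟩, ⟨x⁻¹, ?_⟩⟩
    · rw [pow_one, pow_one, ← hx]; exact Subgroup.mem_zpowers _
    · have : b ∈ Subgroup.zpowers (x * a * x⁻¹) := hx ▸ Subgroup.mem_zpowers b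
      obtain ⟨i, hi⟩ := this
      refine ⟨i, ?_⟩
      simp only [conj_zpow] at hi
      simp only [pow_one, ← hi]
      group
  · rintro ⟨⟨x, hx⟩, ⟨y, hy⟩⟩
    rw [pow_one, pow_one] at hx hy
    refine ⟨x, ?_⟩
    rw [hmap]
    refine Subgroup.eq_of_le_of_card_ge (Subgroup.zpowers_le.2 hx) ?_
    rw [Nat.card_zpowers, Nat.card_zpowers, hord, ← hord y b]
    exact Nat.le_of_dvd (orderOf_pos a) (orderOf_dvd_of_mem_zpowers hy)

theorem subConj_zpowers_pow_iff [Finite G] {K : ℕ} {a b : G} :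
    SubConj (Subgroup.zpowers (a ^ K)) (Subgroup.zpowers (b ^ K)) ↔ powSetoid G K a b :=
  subConj_zpowers_iff.trans (and_congr powSubconj_one_pow_iff powSubconj_one_pow_iff)

theorem isPowClassFun_one_of_mem [Fintype G] {P : Set ℕ} {f : G → ℤ}
    (hf : f ∈ intCharacterRing G P) : IsPowClassFun 1 f := by
  intro g h hgh
  obtain ⟨x, hx⟩ := subConj_zpowers_iff.2 hgh
  have hmap : (Subgroup.zpowers g).map (MulAut.conj x).toMonoidHom =
      Subgroup.zpowers (x * g * x⁻¹) := by
    rw [MonoidHom.map_zpowers]; simp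
  rw [hmap] at hx
  rw [← apply_conj_of_mem_intCharacterRing hf x g]
  obtain ⟨k, hk⟩ := mem_powers_iff_mem_zpowers.2 (hx ▸ Subgroup.mem_zpowers (x * g * x⁻¹))
  simp only at hk
  have ho : orderOf (h ^ k) = orderOf h := by
    rw [hk, ← Nat.card_zpowers, hx, Nat.card_zpowers]
  rw [orderOf_pow] at ho
  have hc : k.Coprime (orderOf h) := by
    rw [Nat.coprime_comm]
    have h2 := Nat.div_mul_cancel (Nat.gcd_dvd_left (orderOf h) k)
    rw [ho] at h2
    exact Nat.eq_of_mul_eq_mul_left (orderOf_pos h) (h2.trans (mul_one _).symm)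
  rw [← hk, apply_pow_eq_of_mem_intCharacterRing hf hc]

/-- A triangular family of functions in a subring yields multiples of indicator functions of
classes. -/
theorem intCast_mul_powClassInd_mem [Fintype G] {B : Subring (G → ℤ)} {K : ℕ} {π : G → G → ℤ}
    {c : G → ℤ} (hB : ∀ g, π g ∈ B) (hzero : ∀ g x, ¬ PowSubconj K x g → π g x = 0)
    (hc : ∀ g x, powSetoid G K x g → π g x = c g) (g : G) :
    ((c g * ∏ h ∈ Finset.univ.filter fun h => PowSubconj K h g ∧ ¬ PowSubconj K g h, c h : ℤ) :
      G → ℤ) * powClassInd K g ∈ B := by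
  set s := Finset.univ.filter fun h => PowSubconj K h g ∧ ¬ PowSubconj K g h with hs
  have : ((c g * ∏ h ∈ s, c h : ℤ) : G → ℤ) * powClassInd K g =
      π g * ∏ h ∈ s, ((c h : G → ℤ) - π h) := by
    ext x
    simp only [Pi.mul_apply, Finset.prod_apply, Pi.sub_apply, Pi.intCast_apply, Int.cast_id,
      powClassInd]
    split_ifs with hx
    · rw [mul_one, hc g x hx]
      congr 1
      refine Finset.prod_congr rfl fun h hh => ?_
      rw [hzero h x, sub_zero]
      intro hxh
      exact (Finset.mem_filter.1 hh).2.2 (hx.2.trans hxh)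
    · rw [mul_zero, eq_comm]
      by_cases hxg : PowSubconj K x g
      · refine mul_eq_zero_of_right _ (Finset.prod_eq_zero (i := x) ?_ ?_)
        · exact Finset.mem_filter.2 ⟨Finset.mem_univ x, hxg, fun h => hx ⟨hxg, h⟩⟩
        · rw [hc x x ((powSetoid G K).refl' x), sub_self]
      · rw [hzero g x hxg, zero_mul]
  rw [this]
  exact B.mul_mem (hB g) (B.prod_mem fun h _ => B.sub_mem (intCast_mem B _) (hB h))

theorem IsPowClassFun.mem_of_powClassInd_mem [Fintype G] {B : AddSubgroup (G → ℤ)} {K : ℕ}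
    (hB : ∀ g, powClassInd K g ∈ B) {f : G → ℤ} (hf : IsPowClassFun K f) : f ∈ B := by
  have : f = ∑ c : Quotient (powSetoid G K), f c.out • powClassInd K c.out := by
    ext x
    rw [Finset.sum_apply, Finset.sum_eq_single (Quotient.mk (powSetoid G K) x)]
    · have hx : powSetoid G K x (Quotient.mk (powSetoid G K) x).out :=
        (powSetoid G K).symm' (Quotient.mk_out (s := powSetoid G K) x)
      rw [Pi.smul_apply, powClassInd, if_pos hx, smul_eq_mul, mul_one]
      exact hf _ _ hx
    · intro c _ hc
      rw [Pi.smul_apply, powClassInd, if_neg, smul_zero]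
      intro hx
      exact hc ((Quotient.out_eq c).symm.trans (Quotient.sound ((powSetoid G K).symm' hx)))
    · simp
  rw [this]
  exact B.sum_mem fun c _ => B.zsmul_mem (hB _) _

end PowerClasses

section LocalIdempotents

variable {G : Type} [Group G] [Fintype G]

/-- Up to a common denominator, every integer-valued function that is constant on the classes of
elements generating conjugate subgroups is a virtual character. -/
theorem exists_natCast_mul_mem (G : Type) [Group G] [Fintype G] (P : Set ℕ) :
    ∃ N : ℕ, N ≠ 0 ∧ ∀ f : G → ℤ, IsPowClassFun 1 f → (N : G → ℤ) * f ∈ intCharacterRing G P := by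
  have hmem : ∀ g : G, permChar (Subgroup.zpowers g) ∈ intCharacterRing G P :=
    fun g => permChar_mem P _
  have hne : ∀ g : G, permChar (Subgroup.zpowers g) g ≠ 0 := fun g =>
    permChar_ne_zero_iff.2 ⟨1, by simp⟩
  have key := intCast_mul_powClassInd_mem (K := 1) (π := fun g => permChar (Subgroup.zpowers g))
    (c := fun g => permChar (Subgroup.zpowers g) g) hmem
    (fun g x hx => by
      by_contra h
      obtain ⟨y, hy⟩ := permChar_ne_zero_iff.1 h
      exact hx ⟨y⁻¹, by simpa using hy⟩)
    (fun g x hx => isPowClassFun_one_of_mem (hmem g) x g hx)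
  set n : G → ℤ := fun g => permChar (Subgroup.zpowers g) g *
    ∏ h ∈ Finset.univ.filter fun h => PowSubconj 1 h g ∧ ¬ PowSubconj 1 g h,
      permChar (Subgroup.zpowers h) h with hn
  have hn0 : ∀ g, n g ≠ 0 := fun g =>
    mul_ne_zero (hne g) (Finset.prod_ne_zero_iff.2 fun h _ => hne h)
  refine ⟨(∏ g, n g).natAbs, Int.natAbs_ne_zero.2 (Finset.prod_ne_zero_iff.2 fun g _ => hn0 g),
    fun f hf => ?_⟩
  let B : AddSubgroup (G → ℤ) := (intCharacterRing G P).toAddSubgroup.comap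
    (AddMonoidHom.mulLeft ((∏ g, n g).natAbs : G → ℤ))
  refine hf.mem_of_powClassInd_mem (B := B) fun g => ?_
  obtain ⟨k, hk⟩ : n g ∣ ((∏ g, n g).natAbs : ℤ) :=
    Int.dvd_natAbs.2 (Finset.dvd_prod_of_mem n (Finset.mem_univ g))
  change ((∏ g, n g).natAbs : G → ℤ) * powClassInd 1 g ∈ intCharacterRing G P
  have : (((∏ g, n g).natAbs : ℕ) : G → ℤ) = ((k : ℤ) : G → ℤ) * ((n g : ℤ) : G → ℤ) := by
    rw [← Int.cast_natCast, hk]; push_cast; ring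
  rw [this, mul_assoc]
  exact Subring.mul_mem _ (intCast_mem _ k) (key g)

/-- The elements of a commutative ring having a multiple prime to `p` in a given subring. -/
def Subring.primeToMultiples {R : Type*} [CommRing R] (A : Subring R) {p : ℕ} (hp : p.Prime) :
    Subring R where
  carrier := {f | ∃ m : ℕ, ¬ p ∣ m ∧ (m : R) * f ∈ A}
  zero_mem' := ⟨1, hp.one_lt.ne' ∘ Nat.dvd_one.1, by simp⟩
  one_mem' := ⟨1, hp.one_lt.ne' ∘ Nat.dvd_one.1, by simp⟩
  add_mem' := by
    rintro x y ⟨m, hm, hx⟩ ⟨n, hn, hy⟩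
    refine ⟨m * n, hp.not_dvd_mul hm hn, ?_⟩
    have : ((m * n : ℕ) : R) * (x + y) = n * (m * x) + m * (n * y) := by push_cast; ring
    rw [this]
    exact A.add_mem (A.mul_mem (natCast_mem A n) hx) (A.mul_mem (natCast_mem A m) hy)
  mul_mem' := by
    rintro x y ⟨m, hm, hx⟩ ⟨n, hn, hy⟩
    refine ⟨m * n, hp.not_dvd_mul hm hn, ?_⟩
    have : ((m * n : ℕ) : R) * (x * y) = (m * x) * (n * y) := by push_cast; ring
    rw [this]
    exact A.mul_mem hx hy
  neg_mem' := by
    rintro x ⟨m, hm, hx⟩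
    exact ⟨m, hm, by rw [mul_neg]; exact A.neg_mem hx⟩

/-- The indicator function of the set where a virtual character is nonzero modulo `p`. -/
theorem ite_dvd_mem_primeToMultiples {P : Set ℕ} {p : ℕ} (hp : p.Prime) {f : G → ℤ}
    (hf : f ∈ intCharacterRing G P) :
    (fun g => if (p : ℤ) ∣ f g then 0 else 1 : G → ℤ) ∈
      (intCharacterRing G P).primeToMultiples hp := by
  obtain ⟨N, hN, hmem⟩ := exists_natCast_mul_mem G P
  obtain ⟨a, m, hpm, rfl⟩ := Nat.exists_eq_pow_mul_and_not_dvd hN p hp.ne_one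
  set e : G → ℤ := fun g => if (p : ℤ) ∣ f g then 0 else 1 with he
  set E := Nat.totient (p ^ a) * (a + 1) with hE
  have hcong : ∀ g, ((p ^ a : ℕ) : ℤ) ∣ f g ^ E - e g := by
    intro g
    simp only [he]
    split_ifs with hg
    · rw [sub_zero]
      push_cast
      refine (pow_dvd_pow_of_dvd hg a).trans (pow_dvd_pow _ ?_)
      have : 0 < Nat.totient (p ^ a) := Nat.totient_pos.2 (pow_pos hp.pos a)
      nlinarith
    · have hc : IsCoprime (f g) ((p ^ a : ℕ) : ℤ) := by
        push_cast
        exact (((Nat.prime_iff_prime_int.1 hp).coprime_iff_not_dvd).2 hg).symm.pow_right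
      rw [← Int.modEq_iff_dvd, hE, pow_mul]
      obtain ⟨u, hu⟩ := (ZMod.coe_int_isUnit_iff_isCoprime (f g) (p ^ a)).2 hc.symm
      have : (f g ^ Nat.totient (p ^ a)) ≡ 1 [ZMOD (p ^ a : ℕ)] := by
        rw [← ZMod.intCast_eq_intCast_iff]
        push_cast
        rw [← hu, ← Units.val_pow_eq_pow_val, ZMod.pow_totient, Units.val_one]
      simpa using (this.pow (a + 1)).symm
  choose q hq using hcong
  have hqc : IsPowClassFun 1 q := by
    have hfc := isPowClassFun_one_of_mem hf
    intro x y hxy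
    have h1 := hq x
    have h2 := hq y
    simp only [he] at h1 h2
    rw [hfc x y hxy, h2] at h1
    exact (mul_left_cancel₀ (by exact_mod_cast (pow_pos hp.pos a).ne') h1).symm
  refine ⟨m, hpm, ?_⟩
  have : (m : G → ℤ) * e = m * f ^ E - ((p ^ a * m : ℕ) : G → ℤ) * q := by
    ext g
    have := hq g
    simp only [Pi.mul_apply, Pi.sub_apply, Pi.pow_apply, Pi.natCast_apply]
    push_cast at this ⊢
    linear_combination (-(m : ℤ)) * this
  rw [this]
  exact Subring.sub_mem _ (Subring.mul_mem _ (natCast_mem _ m) (Subring.pow_mem _ hf E))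
    (hmem q hqc)

/-- Raising to a power composed of primes in `P` does not change the values modulo `p` if `p` is
the only prime involved. -/
theorem dvd_apply_pow_sub_of_forall_prime {P : Set ℕ} {f : G → ℤ}
    (hf : f ∈ intCharacterRing G P) {p : ℕ} (hpP : p ∈ P) {K : ℕ} (hK0 : K ≠ 0)
    (hK : ∀ r : ℕ, r.Prime → r ∣ K → r = p) (g : G) :
    (p : ℤ) ∣ f (g ^ K) - f g := by
  induction K using Nat.recOnMul generalizing g with
  | zero => exact absurd rfl hK0
  | one => simp
  | prime r hr =>
    obtain rfl := hK r hr dvd_rfl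
    exact dvd_apply_pow_sub_of_mem_intCharacterRing hf hr hpP g
  | mul a b ha hb =>
    have h1 := ha (left_ne_zero_of_mul hK0) (fun r hr hd => hK r hr (hd.mul_right b)) g
    have h2 := hb (right_ne_zero_of_mul hK0) (fun r hr hd => hK r hr (hd.mul_left a)) (g ^ a)
    rw [pow_mul]
    simpa using dvd_add h2 h1

/-- A function constant on `p`-classes is a virtual character after localization at `p`. -/
theorem IsPowClassFun.mem_primeToMultiples {P : Set ℕ} {p : ℕ} (hp : p.Prime) (hpP : p ∈ P)
    {K L : ℕ} (hKL : Fintype.card G = K * L) (hK : ∀ r : ℕ, r.Prime → r ∣ K → r = p)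
    (hL : ¬ p ∣ L) {f : G → ℤ} (hf : IsPowClassFun K f) :
    f ∈ (intCharacterRing G P).primeToMultiples hp := by
  have hK0 : K ≠ 0 := by
    rintro rfl
    exact Fintype.card_ne_zero (hKL.trans (zero_mul L))
  have hcop : ∀ g : G, (orderOf (g ^ K)).Coprime p := by
    intro g
    have : orderOf (g ^ K) ∣ L := orderOf_dvd_of_pow_eq_one (by
      rw [← pow_mul, ← hKL, pow_card_eq_one])
    exact (((Nat.Prime.coprime_iff_not_dvd hp).2 hL).coprime_dvd_right this).symm
  choose H hH hHp using fun g : G => exists_not_dvd_permChar hp (hcop g)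
  have hmem : ∀ g, permChar (H g) ∈ intCharacterRing G P := fun g => permChar_mem P _
  have hdvd : ∀ g x, (p : ℤ) ∣ permChar (H g) x ↔ (p : ℤ) ∣ permChar (H g) (x ^ K) := fun g x =>
    (dvd_iff_dvd_of_dvd_sub (dvd_apply_pow_sub_of_forall_prime (hmem g) hpP hK0 hK x)).symm
  have key := intCast_mul_powClassInd_mem (B := (intCharacterRing G P).primeToMultiples hp)
    (K := K) (π := fun g x => if (p : ℤ) ∣ permChar (H g) x then 0 else 1) (c := fun _ => 1)
    (fun g => ite_dvd_mem_primeToMultiples hp (hmem g))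
    (fun g x hx => by
      rw [if_pos]
      by_contra h
      rw [hdvd] at h
      obtain ⟨y, hy⟩ := permChar_ne_zero_iff.1 fun h0 => h (h0 ▸ dvd_zero _)
      refine hx ⟨y⁻¹, ?_⟩
      rw [inv_inv]
      refine hH g _ hy ?_
      have : orderOf (y⁻¹ * x ^ K * y) = orderOf (x ^ K) := by
        simpa using MulEquiv.orderOf_eq (MulAut.conj y⁻¹) (x ^ K)
      rw [this]
      exact hcop x)
    (fun g x hx => by
      rw [if_neg]
      rw [hdvd, isPowClassFun_one_of_mem (hmem g) (x ^ K) (g ^ K)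
        ⟨powSubconj_one_pow_iff.2 hx.1, powSubconj_one_pow_iff.2 hx.2⟩]
      exact hHp g)
  refine hf.mem_of_powClassInd_mem
    (B := ((intCharacterRing G P).primeToMultiples hp).toAddSubgroup) fun g => ?_
  simpa using key g

end LocalIdempotents

section GlobalIdempotents

theorem Nat.exists_eq_mul_of_primes (P : Set ℕ) {n : ℕ} (hn : n ≠ 0) :
    ∃ K L : ℕ, n = K * L ∧ (∀ p : ℕ, p.Prime → p ∣ K → p ∈ P) ∧
      ∀ p : ℕ, p.Prime → p ∣ L → p ∉ P := by
  induction n using Nat.recOnMul with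
  | zero => exact absurd rfl hn
  | one => exact ⟨1, 1, rfl, fun p hp hd => absurd (Nat.dvd_one.1 hd) hp.ne_one,
      fun p hp hd => absurd (Nat.dvd_one.1 hd) hp.ne_one⟩
  | prime p hp =>
    by_cases h : p ∈ P
    · refine ⟨p, 1, (mul_one p).symm, fun r hr hd => ?_,
        fun r hr hd => absurd (Nat.dvd_one.1 hd) hr.ne_one⟩
      rwa [(Nat.prime_dvd_prime_iff_eq hr hp).1 hd]
    · refine ⟨1, p, (one_mul p).symm, fun r hr hd => absurd (Nat.dvd_one.1 hd) hr.ne_one,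
        fun r hr hd => ?_⟩
      rwa [(Nat.prime_dvd_prime_iff_eq hr hp).1 hd]
  | mul a b ha hb =>
    obtain ⟨K, L, rfl, hK, hL⟩ := ha (left_ne_zero_of_mul hn)
    obtain ⟨K', L', rfl, hK', hL'⟩ := hb (right_ne_zero_of_mul hn)
    exact ⟨K * K', L * L', by ring, fun p hp hd => (hp.dvd_mul.1 hd).elim (hK p hp) (hK' p hp),
      fun p hp hd => (hp.dvd_mul.1 hd).elim (hL p hp) (hL' p hp)⟩

variable {G : Type} [Group G] [Fintype G] {P : Set ℕ} {K L : ℕ}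

/-- A function constant on `P`-classes is a virtual character with coefficients in `ℤ_(P)`. -/
theorem IsPowClassFun.mem_intCharacterRing
    (hKL : Fintype.card G = K * L) (hL : ∀ p : ℕ, p.Prime → p ∣ L → p ∉ P)
    {f : G → ℤ} (hf : IsPowClassFun K f) : f ∈ intCharacterRing G P := by
  let I : AddSubgroup ℤ := (intCharacterRing G P).toAddSubgroup.comap
    ((AddMonoidHom.mulRight f).comp (Int.castAddHom (G → ℤ)))
  have hI : ∀ n : ℤ, n ∈ I ↔ (n : G → ℤ) * f ∈ intCharacterRing G P := fun n => Iff.rfl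
  obtain ⟨d, hd⟩ := Int.subgroup_cyclic I
  have hdvd : ∀ n : ℤ, (n : G → ℤ) * f ∈ intCharacterRing G P → d ∣ n := fun n hn => by
    rw [← hI, hd] at hn
    exact Int.mem_zmultiples_iff.1 (by rwa [AddSubgroup.zmultiples_eq_closure])
  have hdI : ((d.natAbs : ℤ) : G → ℤ) * f ∈ intCharacterRing G P := by
    rw [← hI, hd, ← AddSubgroup.zmultiples_eq_closure, Int.mem_zmultiples_iff]
    exact Int.dvd_natAbs.2 dvd_rfl
  obtain ⟨N, hN, hmem⟩ := exists_natCast_mul_mem G P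
  have hd0 : d.natAbs ≠ 0 := by
    intro h
    have := hdvd N (by simpa using hmem f (hf.of_dvd (one_dvd K)))
    rw [Int.natAbs_eq_zero.1 h, zero_dvd_iff] at this
    exact hN (by exact_mod_cast this)
  refine mem_intCharacterRing_of_natCast_mul hd0 (fun p hp hpd hpP => ?_) (by simpa using hdI)
  obtain ⟨K', L', hKL', hK', hL'⟩ := Nat.exists_eq_mul_of_primes {p} (Fintype.card_ne_zero (α := G))
  have hpL' : ¬ p ∣ L' := fun h => hL' p hp h rfl
  have hcop : K'.Coprime L := Nat.Coprime.symm <| Nat.coprime_of_dvd fun r hr h1 h2 =>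
    hL r hr h1 (by rw [Set.mem_singleton_iff.1 (hK' r hr h2)]; exact hpP)
  have hKK' : K' ∣ K := hcop.dvd_of_dvd_mul_right (hKL ▸ hKL' ▸ dvd_mul_right K' L')
  obtain ⟨m, hm, hmf⟩ := (hf.of_dvd hKK').mem_primeToMultiples hp hpP hKL' hK' hpL'
  have := hdvd m (by simpa using hmf)
  exact hm (Int.natCast_dvd_natCast.1 ((Int.natCast_dvd.2 hpd).trans this))

/-- Integer-valued idempotent virtual characters are constant on `P`-classes. -/
theorem isPowClassFun_of_mul_self {f : G → ℤ} (hf : f ∈ intCharacterRing G P)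
    (hff : f * f = f) (hKL : Fintype.card G = K * L)
    (hK : ∀ p : ℕ, p.Prime → p ∣ K → p ∈ P) : IsPowClassFun K f := by
  have h01 : ∀ g, f g = 0 ∨ f g = 1 := fun g => by
    have := congrFun hff g
    simp only [Pi.mul_apply] at this
    rcases eq_or_ne (f g) 0 with h | h
    · exact Or.inl h
    · exact Or.inr (mul_left_cancel₀ h (this.trans (mul_one _).symm))
  have hK0 : K ≠ 0 := by
    rintro rfl
    exact Fintype.card_ne_zero (hKL.trans (zero_mul L))
  have hpow : ∀ g, f (g ^ K) = f g := by
    clear hKL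
    induction K using Nat.recOnMul with
    | zero => exact absurd rfl hK0
    | one => simp
    | prime p hp =>
      intro g
      have := dvd_apply_pow_sub_of_mem_intCharacterRing hf hp (hK p hp dvd_rfl) g
      refine sub_eq_zero.1 (Int.eq_zero_of_abs_lt_dvd this ?_)
      have h2 : (2 : ℤ) ≤ p := by exact_mod_cast hp.two_le
      rcases h01 (g ^ p) with h | h <;> rcases h01 g with h' | h' <;> rw [h, h'] <;> simp <;> omega
    | mul a b ha hb =>
      intro g
      rw [pow_mul, hb (fun r hr hd => hK r hr (hd.mul_left a)) (right_ne_zero_of_mul hK0),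
        ha (fun r hr hd => hK r hr (hd.mul_right b)) (left_ne_zero_of_mul hK0)]
  intro g h hgh
  rw [← hpow g, ← hpow h]
  exact isPowClassFun_one_of_mem hf _ _
    ⟨powSubconj_one_pow_iff.2 hgh.1, powSubconj_one_pow_iff.2 hgh.2⟩

end GlobalIdempotents

section PerfectPart

variable {G : Type} [Group G] [Fintype G] {P : Set ℕ} {K L : ℕ}

omit [Fintype G] in
theorem zpowers_pow_eq_of_coprime [Finite G] {b : G} (h : K.Coprime (orderOf b)) :
    Subgroup.zpowers (b ^ K) = Subgroup.zpowers b := by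
  refine Subgroup.eq_of_le_of_card_ge
    (Subgroup.zpowers_le.2 (pow_mem (Subgroup.mem_zpowers b) K)) ?_
  rw [Nat.card_zpowers, Nat.card_zpowers, orderOf_pow, Nat.coprime_comm.1 h, Nat.div_one]

theorem IsPPrimePart.zpowers_eq (hKL : Fintype.card G = K * L)
    (hK : ∀ p : ℕ, p.Prime → p ∣ K → p ∈ P) (hL : ∀ p : ℕ, p.Prime → p ∣ L → p ∉ P)
    {g b : G} (h : IsPPrimePart P g b) : Subgroup.zpowers b = Subgroup.zpowers (g ^ K) := by
  obtain ⟨⟨i, hi⟩, hb, hc⟩ := h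
  simp only at hi
  have hcomm : Commute (g * b⁻¹) b := by
    rw [← hi]
    exact (((Commute.refl g).zpow_right i).mul_left ((Commute.refl _).inv_left))
  have hcK : (g * b⁻¹) ^ K = 1 := by
    refine orderOf_dvd_iff_pow_eq_one.1 ?_
    have hcop : (orderOf (g * b⁻¹)).Coprime L :=
      Nat.coprime_of_dvd fun p hp h1 h2 => hL p hp h2 (hc p hp h1)
    exact hcop.dvd_of_dvd_mul_right (hKL ▸ orderOf_dvd_card)
  have hg : g ^ K = b ^ K := by
    conv_lhs => rw [← inv_mul_cancel_right g b]
    rw [hcomm.mul_pow, hcK, one_mul]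
  rw [hg, zpowers_pow_eq_of_coprime]
  exact Nat.coprime_of_dvd fun p hp h1 h2 => hb p hp h2 (hK p hp h1)

theorem exists_isPPrimePart (hKL : Fintype.card G = K * L)
    (hK : ∀ p : ℕ, p.Prime → p ∣ K → p ∈ P) (hL : ∀ p : ℕ, p.Prime → p ∣ L → p ∉ P)
    (g : G) : ∃ b, IsPPrimePart P g b := by
  have hcop : K.Coprime L := Nat.coprime_of_dvd fun p hp h1 h2 => hL p hp h2 (hK p hp h1)
  obtain ⟨t, ht0, ht1⟩ := Nat.chineseRemainder hcop 0 1
  have hgKL : orderOf g ∣ K * L := hKL ▸ orderOf_dvd_card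
  refine ⟨g ^ t, pow_mem (Subgroup.mem_zpowers g) t, fun p hp hd => hL p hp (hd.trans ?_),
    fun p hp hd => hK p hp (hd.trans ?_)⟩
  · refine orderOf_dvd_of_pow_eq_one ?_
    rw [← pow_mul]
    exact orderOf_dvd_iff_pow_eq_one.1
      (hgKL.trans (Nat.mul_dvd_mul_right ((Nat.modEq_zero_iff_dvd).1 ht0) L))
  · refine orderOf_dvd_of_pow_eq_one ?_
    have hcomm : Commute g (g ^ t)⁻¹ := ((Commute.refl g).pow_right t).inv_right
    rw [hcomm.mul_pow, inv_pow, mul_inv_eq_one, ← pow_mul, pow_eq_pow_iff_modEq]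
    refine Nat.ModEq.of_dvd hgKL ?_
    have := (ht1.mul_left' K).symm
    rwa [mul_one, mul_comm K t] at this

theorem eIdem_eq_powClassInd (hKL : Fintype.card G = K * L)
    (hK : ∀ p : ℕ, p.Prime → p ∣ K → p ∈ P) (hL : ∀ p : ℕ, p.Prime → p ∣ L → p ∉ P)
    (g : G) : eIdem P (Subgroup.zpowers (g ^ K)) = fun x => (powClassInd K g x : ℂ) := by
  ext x
  have : (∃ b, IsPPrimePart P x b ∧
      SubConj (Subgroup.zpowers b) (Subgroup.zpowers (g ^ K))) ↔ powSetoid G K x g := by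
    rw [← subConj_zpowers_pow_iff]
    constructor
    · rintro ⟨b, hb, h⟩
      rwa [hb.zpowers_eq hKL hK hL] at h
    · intro h
      obtain ⟨b, hb⟩ := exists_isPPrimePart hKL hK hL x
      exact ⟨b, hb, by rwa [hb.zpowers_eq hKL hK hL]⟩
  simp only [eIdem, powClassInd, this]
  split_ifs <;> simp

theorem cyclicPPerfect_iff (hKL : Fintype.card G = K * L)
    (hK : ∀ p : ℕ, p.Prime → p ∣ K → p ∈ P) (hL : ∀ p : ℕ, p.Prime → p ∣ L → p ∉ P)
    {C : Subgroup G} : CyclicPPerfect P C ↔ ∃ g : G, C = Subgroup.zpowers (g ^ K) := by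
  constructor
  · rintro ⟨hC, hCP⟩
    obtain ⟨b, rfl⟩ := (Subgroup.isCyclic_iff_exists_zpowers_eq_top C).1 hC
    refine ⟨b, (zpowers_pow_eq_of_coprime ?_).symm⟩
    exact Nat.coprime_of_dvd fun p hp h1 h2 => hCP p hp (hK p hp h1) (by rwa [Nat.card_zpowers])
  · rintro ⟨g, rfl⟩
    refine ⟨inferInstance, fun p hp hpP hd => hL p hp (hd.trans ?_) hpP⟩
    rw [Nat.card_zpowers]
    exact orderOf_dvd_of_pow_eq_one (by rw [← pow_mul, ← hKL, pow_card_eq_one])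

theorem exists_intCharacterRing_of_mul_self {e : G → ℂ} (he : e ∈ RUP G P) (hee : e * e = e) :
    ∃ f ∈ intCharacterRing G P, f * f = f ∧ e = fun g => (f g : ℂ) := by
  have h01 : ∀ g, e g = 0 ∨ e g = 1 := fun g => by
    have := congrFun hee g
    simp only [Pi.mul_apply] at this
    rcases eq_or_ne (e g) 0 with h | h
    · exact Or.inl h
    · exact Or.inr (mul_left_cancel₀ h (this.trans (mul_one _).symm))
  have hef : e = fun g => ((if e g = 0 then 0 else 1 : ℤ) : ℂ) := by
    ext g
    rcases h01 g with h | h <;> simp [h]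
  refine ⟨fun g => if e g = 0 then 0 else 1, ?_, ?_, hef⟩
  · rw [mem_intCharacterRing, ← hef]; exact he
  · ext g
    simp

omit [Fintype G] in
theorem powClassInd_mul {f : G → ℤ} (hf : IsPowClassFun K f) (g : G) :
    powClassInd K g * f = fun x => f g * powClassInd K g x := by
  ext x
  simp only [powClassInd, Pi.mul_apply]
  split_ifs with hx
  · rw [hf x g hx, mul_one, one_mul]
  · simp

theorem isPrimitiveIdempotentIn_powClassInd (hKL : Fintype.card G = K * L)
    (hK : ∀ p : ℕ, p.Prime → p ∣ K → p ∈ P) (hL : ∀ p : ℕ, p.Prime → p ∣ L → p ∉ P)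
    (g : G) : IsPrimitiveIdempotentIn (RUP G P) fun x => (powClassInd K g x : ℂ) := by
  have hgg : powClassInd K g g = 1 := if_pos ((powSetoid G K).refl' g)
  refine ⟨mem_intCharacterRing.1 ((isPowClassFun_powClassInd K g).mem_intCharacterRing hKL hL),
    ?_, ?_, ?_⟩
  · ext x
    simp [powClassInd]
  · intro h
    simpa [hgg] using congrFun h g
  · intro e₁ e₂ h₁ h₂ h₁₁ h₂₂ h₁₂ hsum
    have zero_of : ∀ e : G → ℂ, e ∈ RUP G P → e * e = e →
        (fun x => (powClassInd K g x : ℂ)) * e = e → e g = 0 → e = 0 := by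
      intro e he hee hmul heg
      obtain ⟨f, hf, hff, rfl⟩ := exists_intCharacterRing_of_mul_self he hee
      have hfc := powClassInd_mul (isPowClassFun_of_mul_self hf hff hKL hK) g
      have hfg : f g = 0 := Int.cast_eq_zero.1 heg
      rw [← hmul]
      ext x
      have := congrFun hfc x
      simp only [Pi.mul_apply, hfg, zero_mul, Pi.zero_apply] at this ⊢
      exact_mod_cast this
    have h₂₁ : e₂ * e₁ = 0 := by rw [mul_comm, h₁₂]
    have hg := congrFun h₁₂ g
    rcases mul_eq_zero.1 hg with h | h
    · exact Or.inl (zero_of e₁ h₁ h₁₁ (by rw [hsum, add_mul, h₁₁, h₂₁, add_zero]) h)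
    · exact Or.inr (zero_of e₂ h₂ h₂₂ (by rw [hsum, add_mul, h₂₂, h₁₂, zero_add]) h)

theorem IsPrimitiveIdempotentIn.exists_eq_powClassInd (hKL : Fintype.card G = K * L)
    (hK : ∀ p : ℕ, p.Prime → p ∣ K → p ∈ P) (hL : ∀ p : ℕ, p.Prime → p ∣ L → p ∉ P)
    {e : G → ℂ} (he : IsPrimitiveIdempotentIn (RUP G P) e) :
    ∃ g, e = fun x => (powClassInd K g x : ℂ) := by
  obtain ⟨heR, hee, he0, hprim⟩ := he
  obtain ⟨g, hg⟩ : ∃ g, e g ≠ 0 := by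
    by_contra! h
    exact he0 (funext h)
  obtain ⟨hi, hii, hi0, -⟩ := isPrimitiveIdempotentIn_powClassInd hKL hK hL g
  have hie : (fun x => (powClassInd K g x : ℂ)) * e = fun x => (powClassInd K g x : ℂ) := by
    obtain ⟨f, hf, hff, rfl⟩ := exists_intCharacterRing_of_mul_self heR hee
    have hfc := powClassInd_mul (isPowClassFun_of_mul_self hf hff hKL hK) g
    have hfg : f g = 1 := by
      have h1 := congrFun hff g
      simp only [Pi.mul_apply] at h1
      exact mul_left_cancel₀ (fun h => hg (Int.cast_eq_zero.2 h)) (h1.trans (mul_one _).symm)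
    ext x
    have := congrFun hfc x
    simp only [Pi.mul_apply, hfg, one_mul] at this ⊢
    exact_mod_cast this
  set i : G → ℂ := fun x => (powClassInd K g x : ℂ) with hidef
  have hsub : e - i ∈ RUP G P := mem_characterRing.1
    ((characterRing G P).sub_mem (mem_characterRing.2 heR) (mem_characterRing.2 hi))
  rcases hprim i (e - i) hi hsub hii
    (by rw [sub_mul, mul_sub, mul_sub, hee, hii, hie, mul_comm e i, hie]; ring)
    (by rw [mul_sub, hii, hie, sub_self]) (by ring) with h | h
  · exact absurd h hi0
  · exact ⟨g, sub_eq_zero.1 h⟩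

end PerfectPart

/-- `C ↦ e_C` defines a bijection between conjugacy classes of cyclic
`P`-perfect subgroups of `G` and primitive idempotents of the ring `RU_P(G)`. -/
theorem eIdem_bijection_primitive_idempotents (G : Type) [Group G] [Fintype G]
    (P : Set ℕ) (hP : ∀ p ∈ P, Nat.Prime p) :
    (∀ C : Subgroup G, CyclicPPerfect P C →
      IsPrimitiveIdempotentIn (RUP G P) (eIdem P C)) ∧
    (∀ C C' : Subgroup G, CyclicPPerfect P C → CyclicPPerfect P C' →
      (eIdem P C = eIdem P C' ↔ SubConj C C')) ∧
    (∀ f : G → ℂ, IsPrimitiveIdempotentIn (RUP G P) f →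
      ∃ C : Subgroup G, CyclicPPerfect P C ∧ f = eIdem P C) := by
  obtain ⟨K, L, hKL, hK, hL⟩ := Nat.exists_eq_mul_of_primes P (Fintype.card_ne_zero (α := G))
  refine ⟨fun C hC => ?_, fun C C' hC hC' => ?_, fun f hf => ?_⟩
  · obtain ⟨g, rfl⟩ := (cyclicPPerfect_iff hKL hK hL).1 hC
    rw [eIdem_eq_powClassInd hKL hK hL]
    exact isPrimitiveIdempotentIn_powClassInd hKL hK hL g
  · obtain ⟨g, rfl⟩ := (cyclicPPerfect_iff hKL hK hL).1 hC
    obtain ⟨h, rfl⟩ := (cyclicPPerfect_iff hKL hK hL).1 hC'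
    rw [eIdem_eq_powClassInd hKL hK hL, eIdem_eq_powClassInd hKL hK hL, subConj_zpowers_pow_iff]
    constructor
    · intro heq
      by_contra hgh
      have := congrFun heq g
      simp [powClassInd, hgh] at this
    · intro hgh
      have hiff : ∀ x, powSetoid G K x g ↔ powSetoid G K x h := fun x =>
        ⟨fun hx => (powSetoid G K).trans' hx hgh,
          fun hx => (powSetoid G K).trans' hx ((powSetoid G K).symm' hgh)⟩
      simp only [powClassInd, hiff]
  · obtain ⟨g, rfl⟩ := hf.exists_eq_powClassInd hKL hK hL
    exact ⟨_, (cyclicPPerfect_iff hKL hK hL).2 ⟨g, rfl⟩, (eIdem_eq_powClassInd hKL hK hL g).symm⟩
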